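/- Let G_U=(U,E_U) be a 3-regular graph with U={u_1,…,u_n} and let k ≤ n be a positive integer, and let I'=(V,E,ℰ,c,D) be the MCRN instance constructed from G_U and k as described. If G_U has a vertex cover of size at most k, then there exists a matching M ⊆ ℰ and a segregated splittable flow serving D in N(M) whose congestion is at most 1. -/

import Mathlib

open Finset

namespace MCRN

/-- A directed link of a reconfigurable network: either a direction of a bidirected
static link (indexed by `E × Bool`) or a directed reconfigurable link `(i, j)`. -/
abbrev SLink (V E : Type*) := (E × Bool) ⊕ (V × V)

variable {V E : Type*}

/-- Tail of a directed link. -/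
def tl (src tgt : E → V) : SLink V E → V
  | .inl (e, b) => if b then src e else tgt e
  | .inr (i, _) => i

/-- Head of a directed link. -/
def hd (src tgt : E → V) : SLink V E → V
  | .inl (e, b) => if b then tgt e else src e
  | .inr (_, j) => j

variable [Fintype V] [DecidableEq V] [Fintype E] [DecidableEq E]

/-- Net outflow of `g` at node `v`. -/
def netOut (src tgt : E → V) (g : SLink V E → ℝ) (v : V) : ℝ :=
  (∑ a : SLink V E, if tl src tgt a = v then g a else 0)
    - ∑ a : SLink V E, if hd src tgt a = v then g a else 0

/-- A matching: a set of non-diagonal unordered pairs, no two sharing an endpoint. -/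
def IsMatching (M : Finset (Sym2 V)) : Prop :=
  (∀ p ∈ M, ¬ p.IsDiag) ∧ ∀ p ∈ M, ∀ q ∈ M, ∀ v : V, v ∈ p → v ∈ q → p = q

/-- A splittable flow serving demands `D` in the reconfigured network `N(M)`:
nonnegative, supported on static links and reconfigurable links of `M`,
conserved away from endpoints, and sending net flow `D i j` from `i` to `j`. -/
structure IsFlow (src tgt : E → V) (D : V → V → ℝ) (M : Finset (Sym2 V))
    (f : V → V → SLink V E → ℝ) : Prop where
  nonneg : ∀ i j a, 0 ≤ f i j a
  supp : ∀ i j p q, s(p, q) ∉ M → f i j (Sum.inr (p, q)) = 0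
  diag : ∀ i a, f i i a = 0
  conserve : ∀ i j v, v ≠ i → v ≠ j → netOut src tgt (f i j) v = 0
  demand : ∀ i j, i ≠ j → netOut src tgt (f i j) i = D i j

/-- A flow is segregated if each positive demand is carried either entirely by the
single directed reconfigurable link `(i, j)` or only by directed static links. -/
def Segregated (D : V → V → ℝ) (f : V → V → SLink V E → ℝ) : Prop :=
  ∀ i j, 0 < D i j →
    (∀ a : SLink V E, a ≠ Sum.inr (i, j) → f i j a = 0) ∨
    ∀ p q : V, f i j (Sum.inr (p, q)) = 0

/-- Total flow on a directed link. -/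
def totalFlow (f : V → V → SLink V E → ℝ) (a : SLink V E) : ℝ := ∑ i, ∑ j, f i j a

/-- The congestion (maximum load) of the flow `f` in `N(M)` is at most `lam`. -/
def CongLE (c : SLink V E → ℝ) (M : Finset (Sym2 V)) (f : V → V → SLink V E → ℝ)
    (lam : ℝ) : Prop :=
  (∀ (e : E) (b : Bool), totalFlow f (Sum.inl (e, b)) ≤ lam * c (Sum.inl (e, b))) ∧
  ∀ p q : V, s(p, q) ∈ M → totalFlow f (Sum.inr (p, q)) ≤ lam * c (Sum.inr (p, q))

/-- The congestion (maximum load) of the flow `f` in `N(M)` is at least `lam`: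
some existing directed link has load at least `lam`. -/
def CongGE (c : SLink V E → ℝ) (M : Finset (Sym2 V)) (f : V → V → SLink V E → ℝ)
    (lam : ℝ) : Prop :=
  (∃ (e : E) (b : Bool), lam * c (Sum.inl (e, b)) ≤ totalFlow f (Sum.inl (e, b))) ∨
  ∃ p q : V, s(p, q) ∈ M ∧ lam * c (Sum.inr (p, q)) ≤ totalFlow f (Sum.inr (p, q))

/-- A (nonempty, repetition-free) directed path from `i` to `j`. -/
def IsDiPath (src tgt : E → V) (i j : V) (P : List (SLink V E)) : Prop :=
  P ≠ [] ∧ P.Nodup ∧ P.Chain' (fun a b => hd src tgt a = tl src tgt b) ∧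
    P.head?.map (tl src tgt) = some i ∧ P.getLast?.map (hd src tgt) = some j

/-- The flow is unsplittable: each positive demand is routed along a single directed path. -/
def Unsplittable (src tgt : E → V) (D : V → V → ℝ) (f : V → V → SLink V E → ℝ) : Prop :=
  ∀ i j, 0 < D i j → ∃ P : List (SLink V E), IsDiPath src tgt i j P ∧
    (∀ a ∈ P, f i j a = D i j) ∧ ∀ a : SLink V E, a ∉ P → f i j a = 0

end MCRN

namespace MCRN
namespace APX

/-- Nodes of the APX-hardness instance built from a 3-regular graph on `Fin n` with
edge set `EU`: `v_i`, `a_i`, `b_i` (`i : Fin n`), `v_e`, `v'_e` (`e ∈ EU`), and `a`, `o`. -/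
abbrev VN (n : ℕ) (EU : Finset (Sym2 (Fin n))) :=
  (Fin n ⊕ Fin n ⊕ Fin n) ⊕ ((↥EU ⊕ ↥EU) ⊕ (Unit ⊕ Unit))

def vN (n : ℕ) (EU : Finset (Sym2 (Fin n))) (i : Fin n) : VN n EU := .inl (.inl i)
def aN (n : ℕ) (EU : Finset (Sym2 (Fin n))) (i : Fin n) : VN n EU := .inl (.inr (.inl i))
def bN (n : ℕ) (EU : Finset (Sym2 (Fin n))) (i : Fin n) : VN n EU := .inl (.inr (.inr i))
def veN (n : ℕ) (EU : Finset (Sym2 (Fin n))) (e : ↥EU) : VN n EU := .inr (.inl (.inl e))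
def veN' (n : ℕ) (EU : Finset (Sym2 (Fin n))) (e : ↥EU) : VN n EU := .inr (.inl (.inr e))
def AN (n : ℕ) (EU : Finset (Sym2 (Fin n))) : VN n EU := .inr (.inr (.inl ()))
def ON (n : ℕ) (EU : Finset (Sym2 (Fin n))) : VN n EU := .inr (.inr (.inr ()))

/-- Incidences of the graph: a pair of an edge `e ∈ EU` and an endpoint `x ∈ e`. -/
abbrev Inc (n : ℕ) (EU : Finset (Sym2 (Fin n))) := Σ e : ↥EU, {x : Fin n // x ∈ e.1}

/-- Static links of the APX-hardness instance: capacity-1 links `{v_x, v_e}`,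
`{v'_e, b_x}` (for each incidence `(e, x)`) and `{v_e, v'_e}` (for each edge `e`);
capacity-3 links `{a_i, a}`, `{v_i, o}` (for each `i`) and `k` parallel `{a, o}` links. -/
abbrev EL (n k : ℕ) (EU : Finset (Sym2 (Fin n))) :=
  (Inc n EU ⊕ Inc n EU ⊕ ↥EU) ⊕ (Fin n ⊕ Fin n ⊕ Fin k)

def Esrc (n k : ℕ) (EU : Finset (Sym2 (Fin n))) : EL n k EU → VN n EU
  | .inl (.inl s) => vN n EU s.2.1
  | .inl (.inr (.inl s)) => veN' n EU s.1
  | .inl (.inr (.inr e)) => veN n EU e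
  | .inr (.inl i) => aN n EU i
  | .inr (.inr (.inl i)) => vN n EU i
  | .inr (.inr (.inr _)) => AN n EU

def Etgt (n k : ℕ) (EU : Finset (Sym2 (Fin n))) : EL n k EU → VN n EU
  | .inl (.inl s) => veN n EU s.1
  | .inl (.inr (.inl s)) => bN n EU s.2.1
  | .inl (.inr (.inr e)) => veN' n EU e
  | .inr (.inl _) => AN n EU
  | .inr (.inr (.inl _)) => ON n EU
  | .inr (.inr (.inr _)) => ON n EU

/-- Capacities: `1` on both directions of the gadget links, `3` on both directions of
all other static links and of all reconfigurable links. -/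
def capA (n k : ℕ) (EU : Finset (Sym2 (Fin n))) :
    SLink (VN n EU) (EL n k EU) → ℝ
  | .inl (.inl _, _) => 1
  | _ => 3

/-- Demands: `D(v_i, b_i) = 3` and `D(v_i, a_i) = 3` for each `i`; all others `0`. -/
def DA (n : ℕ) (EU : Finset (Sym2 (Fin n))) : VN n EU → VN n EU → ℝ
  | .inl (.inl i), .inl (.inr (.inl j)) => if i = j then 3 else 0
  | .inl (.inl i), .inl (.inr (.inr j)) => if i = j then 3 else 0
  | _, _ => 0

/-- A vertex cover of the graph `(Fin n, EU)`. -/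
def IsVC (n : ℕ) (EU : Finset (Sym2 (Fin n))) (C : Finset (Fin n)) : Prop :=
  ∀ e ∈ EU, ∃ x ∈ C, x ∈ e

end APX
end MCRN

namespace MCRN

section NetOut

variable {V E : Type*} [Fintype V] [DecidableEq V] [Fintype E]

theorem netOut_zero (src tgt : E → V) (v : V) :
    netOut src tgt (0 : SLink V E → ℝ) v = 0 := by
  simp [netOut]

theorem netOut_add (src tgt : E → V) (g h : SLink V E → ℝ) (v : V) :
    netOut src tgt (g + h) v = netOut src tgt g v + netOut src tgt h v := by
  have key : ∀ (p : SLink V E → Prop) [DecidablePred p],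
      (∑ a, if p a then g a + h a else 0)
        = (∑ a, if p a then g a else 0) + ∑ a, if p a then h a else 0 := by
    intro p _
    rw [← Finset.sum_add_distrib]
    exact Finset.sum_congr rfl fun a _ => by split_ifs <;> simp
  simp only [netOut, Pi.add_apply, key]
  ring

theorem netOut_sum {ι : Type*} (src tgt : E → V) (s : Finset ι) (g : ι → SLink V E → ℝ) (v : V) :
    netOut src tgt (∑ i ∈ s, g i) v = ∑ i ∈ s, netOut src tgt (g i) v := by
  classical
  induction s using Finset.induction_on with
  | empty => simpa using netOut_zero src tgt v
  | insert i s hi ih => rw [Finset.sum_insert hi, Finset.sum_insert hi, netOut_add, ih]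

theorem netOut_single [DecidableEq E] (src tgt : E → V) (a : SLink V E) (r : ℝ) (v : V) :
    netOut src tgt (Pi.single a r) v
      = (if tl src tgt a = v then r else 0) - if hd src tgt a = v then r else 0 := by
  have key : ∀ (p : SLink V E → Prop) [DecidablePred p],
      (∑ b, if p b then (Pi.single a r : SLink V E → ℝ) b else 0) = if p a then r else 0 := by
    intro p _
    rw [Finset.sum_eq_single a]
    · simp
    · intro b _ hb
      simp [Pi.single_eq_of_ne hb]
    · simp
  rw [netOut, key, key]

end NetOut

namespace APX

set_option synthInstance.maxSize 2000

variable {n k : ℕ} {EU : Finset (Sym2 (Fin n))}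

/-- The unit flow `v_x → v_e → v'_e → b_x` through the gadget of the incidence `(e, x)`. -/
noncomputable def gadgetPath (k : ℕ) (s : Inc n EU) : SLink (VN n EU) (EL n k EU) → ℝ :=
  Pi.single (.inl (.inl (.inl s), true)) 1 + Pi.single (.inl (.inl (.inr (.inr s.1)), true)) 1
    + Pi.single (.inl (.inl (.inr (.inl s)), true)) 1

/-- The flow of value `3` along `v_i → o → a → a_i` using the `j`-th parallel link. -/
noncomputable def hubPath (EU : Finset (Sym2 (Fin n))) (i : Fin n) (j : Fin k) :
    SLink (VN n EU) (EL n k EU) → ℝ :=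
  Pi.single (.inl (.inr (.inr (.inl i)), true)) 3
    + Pi.single (.inl (.inr (.inr (.inr j)), false)) 3
    + Pi.single (.inl (.inr (.inl i), false)) 3

/-- The flow from `v_i` to `b_i`: direct if `i` is in the cover, through the gadgets otherwise. -/
noncomputable def flowB (k : ℕ) (EU : Finset (Sym2 (Fin n))) (C : Finset (Fin n)) (i : Fin n) :
    SLink (VN n EU) (EL n k EU) → ℝ :=
  if i ∈ C then Pi.single (.inr (vN n EU i, bN n EU i)) 3
  else ∑ s : Inc n EU with s.2.1 = i, gadgetPath k s

/-- The flow from `v_i` to `a_i`: through `o` if `i` is in the cover, direct otherwise. -/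
noncomputable def flowA (EU : Finset (Sym2 (Fin n))) (C : Finset (Fin n)) (φ : Fin n → Fin k)
    (i : Fin n) : SLink (VN n EU) (EL n k EU) → ℝ :=
  if i ∈ C then hubPath EU i (φ i) else Pi.single (.inr (vN n EU i, aN n EU i)) 3

/-- The multicommodity flow obtained from a cover `C` and an assignment `φ` of hub links. -/
noncomputable def coverFlow (EU : Finset (Sym2 (Fin n))) (C : Finset (Fin n))
    (φ : Fin n → Fin k) : VN n EU → VN n EU → SLink (VN n EU) (EL n k EU) → ℝ
  | .inl (.inl i), .inl (.inr (.inl j)) => if i = j then flowA EU C φ i else 0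
  | .inl (.inl i), .inl (.inr (.inr j)) => if i = j then flowB k EU C i else 0
  | _, _ => 0

/-- The node matched with `v_i`: `b_i` if `i` is in the cover, `a_i` otherwise. -/
def partner (EU : Finset (Sym2 (Fin n))) (C : Finset (Fin n)) (i : Fin n) : VN n EU :=
  if i ∈ C then bN n EU i else aN n EU i

/-- The matching obtained from a cover. -/
def coverMatching (EU : Finset (Sym2 (Fin n))) (C : Finset (Fin n)) : Finset (Sym2 (VN n EU)) :=
  Finset.univ.image fun i => s(vN n EU i, partner EU C i)

theorem mem_coverMatching_edge {C : Finset (Fin n)} {i : Fin n} {v : VN n EU} :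
    v ∈ s(vN n EU i, partner EU C i) ↔
      v = vN n EU i ∨ (i ∈ C ∧ v = bN n EU i) ∨ (i ∉ C ∧ v = aN n EU i) := by
  by_cases h : i ∈ C <;> simp [partner, h]

theorem isMatching_coverMatching (C : Finset (Fin n)) : IsMatching (coverMatching EU C) := by
  refine ⟨?_, ?_⟩
  · simp only [coverMatching, Finset.mem_image, Finset.mem_univ, true_and, forall_exists_index,
      forall_apply_eq_imp_iff, Sym2.mk_isDiag_iff, partner]
    intro i
    split_ifs <;> simp [vN, aN, bN]
  · simp only [coverMatching, Finset.mem_image, Finset.mem_univ, true_and, forall_exists_index,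
      forall_apply_eq_imp_iff]
    intro i j v hi hj
    suffices i = j by rw [this]
    rw [mem_coverMatching_edge] at hi hj
    rcases hi with rfl | ⟨-, rfl⟩ | ⟨-, rfl⟩ <;> simp [vN, aN, bN] at hj
    exacts [hj, hj.2, hj.2]

theorem netOut_gadgetPath (s : Inc n EU) (v : VN n EU) :
    netOut (Esrc n k EU) (Etgt n k EU) (gadgetPath k s) v
      = (if vN n EU s.2.1 = v then 1 else 0) - if bN n EU s.2.1 = v then 1 else 0 := by
  simp only [gadgetPath, netOut_add, netOut_single, tl, hd, Esrc, Etgt, if_true]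
  ring

theorem netOut_hubPath (i : Fin n) (j : Fin k) (v : VN n EU) :
    netOut (Esrc n k EU) (Etgt n k EU) (hubPath EU i j) v
      = (if vN n EU i = v then 3 else 0) - if aN n EU i = v then 3 else 0 := by
  simp only [hubPath, netOut_add, netOut_single, tl, hd, Esrc, Etgt, if_true, Bool.false_eq_true,
    if_false]
  ring

theorem card_inc (i : Fin n) :
    (Finset.univ.filter fun s : Inc n EU => s.2.1 = i).card = (EU.filter fun e => i ∈ e).card := by
  refine Finset.card_bij' (fun s _ => s.1.1)
    (fun e he => ⟨⟨e, (Finset.mem_filter.1 he).1⟩, ⟨i, (Finset.mem_filter.1 he).2⟩⟩) ?_ ?_ ?_ ?_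
  · rintro ⟨e, x, hx⟩ hs
    obtain rfl : x = i := by simpa using hs
    simp [hx]
  · simp
  · rintro ⟨e, x, hx⟩ hs
    obtain rfl : x = i := by simpa using hs
    rfl
  · simp

theorem netOut_flowB (hreg : ∀ v : Fin n, (EU.filter (fun e => v ∈ e)).card = 3)
    (C : Finset (Fin n)) (i : Fin n) (v : VN n EU) :
    netOut (Esrc n k EU) (Etgt n k EU) (flowB k EU C i) v
      = (if vN n EU i = v then 3 else 0) - if bN n EU i = v then 3 else 0 := by
  by_cases hi : i ∈ C <;> simp only [flowB, hi, if_true, if_false]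
  · rw [netOut_single]
    rfl
  · have h : ∀ s ∈ (Finset.univ.filter fun s : Inc n EU => s.2.1 = i),
        netOut (Esrc n k EU) (Etgt n k EU) (gadgetPath k s) v
          = (if vN n EU i = v then 1 else 0) - if bN n EU i = v then 1 else 0 := by
      intro s hs
      rw [netOut_gadgetPath, (Finset.mem_filter.1 hs).2]
    rw [netOut_sum, Finset.sum_congr rfl h, Finset.sum_const, card_inc, hreg]
    split_ifs <;> norm_num

theorem netOut_flowA (C : Finset (Fin n)) (φ : Fin n → Fin k) (i : Fin n) (v : VN n EU) :
    netOut (Esrc n k EU) (Etgt n k EU) (flowA EU C φ i) v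
      = (if vN n EU i = v then 3 else 0) - if aN n EU i = v then 3 else 0 := by
  by_cases hi : i ∈ C <;> simp only [flowA, hi, if_true, if_false]
  · exact netOut_hubPath i (φ i) v
  · rw [netOut_single]
    rfl

theorem netOut_coverFlow (hreg : ∀ v : Fin n, (EU.filter (fun e => v ∈ e)).card = 3)
    (C : Finset (Fin n)) (φ : Fin n → Fin k) (p q v : VN n EU) :
    netOut (Esrc n k EU) (Etgt n k EU) (coverFlow EU C φ p q) v
      = (if p = v then DA n EU p q else 0) - if q = v then DA n EU p q else 0 := by
  unfold coverFlow DA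
  split
  · rename_i i j
    split_ifs with h <;> first
      | (subst h; rw [netOut_flowA]; simp_all [vN, aN])
      | simp [netOut_zero]
  · rename_i i j
    split_ifs with h <;> first
      | (subst h; rw [netOut_flowB hreg]; simp_all [vN, bN])
      | simp [netOut_zero]
  · simp [netOut_zero]

theorem gadgetPath_nonneg (s : Inc n EU) : 0 ≤ gadgetPath k s := by
  unfold gadgetPath
  have h : ∀ a : SLink (VN n EU) (EL n k EU), (0 : SLink _ _ → ℝ) ≤ Pi.single a 1 :=
    fun a => Pi.single_nonneg.2 zero_le_one
  exact add_nonneg (add_nonneg (h _) (h _)) (h _)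

theorem hubPath_nonneg (i : Fin n) (j : Fin k) : 0 ≤ hubPath EU i j := by
  unfold hubPath
  have h : ∀ a : SLink (VN n EU) (EL n k EU), (0 : SLink _ _ → ℝ) ≤ Pi.single a 3 :=
    fun a => Pi.single_nonneg.2 zero_le_three
  exact add_nonneg (add_nonneg (h _) (h _)) (h _)

theorem flowB_nonneg (C : Finset (Fin n)) (i : Fin n) : 0 ≤ flowB k EU C i := by
  unfold flowB
  split_ifs
  · exact Pi.single_nonneg.2 zero_le_three
  · exact Finset.sum_nonneg fun s _ => gadgetPath_nonneg s

theorem flowA_nonneg (C : Finset (Fin n)) (φ : Fin n → Fin k) (i : Fin n) :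
    0 ≤ flowA EU C φ i := by
  unfold flowA
  split_ifs
  · exact hubPath_nonneg i (φ i)
  · exact Pi.single_nonneg.2 zero_le_three

theorem flowB_inr (C : Finset (Fin n)) (i : Fin n) (p q : VN n EU) :
    flowB k EU C i (.inr (p, q))
      = if i ∈ C ∧ p = vN n EU i ∧ q = bN n EU i then 3 else 0 := by
  by_cases hi : i ∈ C
  · simp [flowB, hi, Pi.single_apply]
  · simp [flowB, hi, gadgetPath]

theorem flowA_inr (C : Finset (Fin n)) (φ : Fin n → Fin k) (i : Fin n) (p q : VN n EU) :
    flowA EU C φ i (.inr (p, q))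
      = if i ∉ C ∧ p = vN n EU i ∧ q = aN n EU i then 3 else 0 := by
  by_cases hi : i ∈ C
  · simp [flowA, hi, hubPath]
  · simp [flowA, hi, Pi.single_apply]

theorem isFlow_coverFlow (hreg : ∀ v : Fin n, (EU.filter (fun e => v ∈ e)).card = 3)
    (C : Finset (Fin n)) (φ : Fin n → Fin k) :
    IsFlow (Esrc n k EU) (Etgt n k EU) (DA n EU) (coverMatching EU C) (coverFlow EU C φ) where
  nonneg p q a := by
    unfold coverFlow
    split
    · split_ifs
      exacts [flowA_nonneg C φ _ a, le_rfl]
    · split_ifs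
      exacts [flowB_nonneg C _ a, le_rfl]
    · exact le_rfl
  supp p q x y hxy := by
    have hM : ∀ i, ¬ (x = vN n EU i ∧ y = partner EU C i) := by
      rintro i ⟨rfl, rfl⟩
      exact hxy (Finset.mem_image_of_mem _ (Finset.mem_univ i))
    unfold coverFlow
    split
    · rename_i i j
      split_ifs
      · rw [flowA_inr, if_neg]
        rintro ⟨hi, h⟩
        exact hM i (by simpa [partner, hi] using h)
      · rfl
    · rename_i i j
      split_ifs
      · rw [flowB_inr, if_neg]
        rintro ⟨hi, h⟩
        exact hM i (by simpa [partner, hi] using h)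
      · rfl
    · rfl
  diag p a := by
    rcases p with (i | i | i) | ((e | e) | (u | u)) <;> rfl
  conserve p q v hp hq := by
    rw [netOut_coverFlow hreg, if_neg hp.symm, if_neg hq.symm, sub_zero]
  demand p q hpq := by
    rw [netOut_coverFlow hreg, if_pos rfl, if_neg hpq.symm, sub_zero]

theorem segregated_coverFlow (C : Finset (Fin n)) (φ : Fin n → Fin k) :
    Segregated (DA n EU) (coverFlow EU C φ) := by
  intro p q hD
  unfold DA at hD
  split at hD
  · rename_i i j
    split_ifs at hD with hij
    · subst hij
      simp only [coverFlow, if_true]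
      by_cases hi : i ∈ C
      · right
        intro x y
        simp [flowA_inr, hi]
      · left
        intro a ha
        simp only [flowA, hi, if_false]
        exact Pi.single_eq_of_ne ha _
    · exact absurd hD (lt_irrefl _)
  · rename_i i j
    split_ifs at hD with hij
    · subst hij
      simp only [coverFlow, if_true]
      by_cases hi : i ∈ C
      · left
        intro a ha
        simp only [flowB, hi, if_true]
        exact Pi.single_eq_of_ne ha _
      · right
        intro x y
        simp [flowB_inr, hi]
    · exact absurd hD (lt_irrefl _)
  · exact absurd hD (lt_irrefl _)

theorem totalFlow_coverFlow (C : Finset (Fin n)) (φ : Fin n → Fin k)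
    (a : SLink (VN n EU) (EL n k EU)) :
    totalFlow (coverFlow EU C φ) a = ∑ i, (flowA EU C φ i a + flowB k EU C i a) := by
  simp [totalFlow, coverFlow, Fintype.sum_sum_type, Finset.sum_add_distrib, ite_apply]

theorem sum_flowB_inl (C : Finset (Fin n)) (l : EL n k EU × Bool) :
    ∑ i, flowB k EU C i (.inl l) = ∑ s : Inc n EU with s.2.1 ∉ C, gadgetPath k s (.inl l) := by
  have h : ∀ i, flowB k EU C i (.inl l)
      = ∑ s : Inc n EU, if s.2.1 = i then (if s.2.1 ∉ C then gadgetPath k s (.inl l) else 0)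
        else 0 := by
    intro i
    rw [← Finset.sum_filter]
    unfold flowB
    split_ifs with hi
    · rw [Pi.single_eq_of_ne (by simp)]
      refine (Finset.sum_eq_zero fun s hs => ?_).symm
      rw [(Finset.mem_filter.1 hs).2, if_neg (not_not.2 hi)]
    · rw [Finset.sum_apply]
      refine Finset.sum_congr rfl fun s hs => ?_
      rw [(Finset.mem_filter.1 hs).2, if_pos hi]
  simp_rw [h]
  rw [Finset.sum_comm, Finset.sum_filter]
  exact Finset.sum_congr rfl fun s _ => by simp

theorem sum_flowA_inl (C : Finset (Fin n)) (φ : Fin n → Fin k) (l : EL n k EU × Bool) :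
    ∑ i, flowA EU C φ i (.inl l) = ∑ i ∈ C, hubPath EU i (φ i) (.inl l) := by
  have h : ∀ i, flowA EU C φ i (.inl l) = if i ∈ C then hubPath EU i (φ i) (.inl l) else 0 := by
    intro i
    unfold flowA
    split_ifs
    · rfl
    · exact Pi.single_eq_of_ne (by simp) _
  simp_rw [h]
  simp

theorem sum_ite_le {ι : Type*} (s : Finset ι) (p : ι → Prop) [DecidablePred p] {r : ℝ}
    (hr : 0 ≤ r) (h : ∀ i ∈ s, ∀ j ∈ s, p i → p j → i = j) :
    (∑ i ∈ s, if p i then r else 0) ≤ r := by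
  have hc : (s.filter p).card ≤ 1 := Finset.card_le_one.2 fun i hi j hj => by
    rw [Finset.mem_filter] at hi hj
    exact h i hi.1 j hj.1 hi.2 hj.2
  rw [← Finset.sum_filter, Finset.sum_const, nsmul_eq_mul]
  exact mul_le_of_le_one_left hr (by exact_mod_cast hc)

theorem inc_unique_of_isVC {C : Finset (Fin n)} (hC : IsVC n EU C) {s t : Inc n EU}
    (hs : s.2.1 ∉ C) (ht : t.2.1 ∉ C) (h : s.1 = t.1) : s = t := by
  obtain ⟨e, x, hx⟩ := s
  obtain ⟨e', y, hy⟩ := t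
  obtain rfl : e = e' := h
  suffices x = y by subst this; rfl
  by_contra hxy
  obtain ⟨z, hz, hze⟩ := hC e.1 e.2
  rw [(Sym2.mem_and_mem_iff hxy).1 ⟨hx, hy⟩, Sym2.mem_iff] at hze
  rcases hze with rfl | rfl
  exacts [hs hz, ht hz]

theorem congLE_coverFlow {C : Finset (Fin n)} (hC : IsVC n EU C) {φ : Fin n → Fin k}
    (hφ : Set.InjOn φ C) :
    CongLE (capA n k EU) (coverMatching EU C) (coverFlow EU C φ) 1 := by
  refine ⟨fun l b => ?_, fun p q _ => ?_⟩
  · rw [one_mul, totalFlow_coverFlow, Finset.sum_add_distrib, sum_flowA_inl, sum_flowB_inl]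
    rcases l with (s | s | e) | (i | i | j)
    · have := sum_ite_le (Finset.univ.filter fun t : Inc n EU => t.2.1 ∉ C)
        (fun t => s = t ∧ b = true) zero_le_one (by rintro t - t' - ⟨rfl, -⟩ ⟨rfl, -⟩; rfl)
      simpa [gadgetPath, hubPath, Pi.single_apply, capA] using this
    · have := sum_ite_le (Finset.univ.filter fun t : Inc n EU => t.2.1 ∉ C)
        (fun t => s = t ∧ b = true) zero_le_one (by rintro t - t' - ⟨rfl, -⟩ ⟨rfl, -⟩; rfl)
      simpa [gadgetPath, hubPath, Pi.single_apply, capA] using this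
    · have := sum_ite_le (Finset.univ.filter fun t : Inc n EU => t.2.1 ∉ C)
        (fun t => e = t.1 ∧ b = true) zero_le_one (by
          rintro t ht t' ht' ⟨rfl, -⟩ ⟨h, -⟩
          exact inc_unique_of_isVC hC (Finset.mem_filter.1 ht).2 (Finset.mem_filter.1 ht').2 h)
      simpa [gadgetPath, hubPath, Pi.single_apply, capA] using this
    · have := sum_ite_le C (fun t => i = t ∧ b = false) zero_le_three
        (by rintro t - t' - ⟨rfl, -⟩ ⟨rfl, -⟩; rfl)
      simpa [gadgetPath, hubPath, Pi.single_apply, capA] using this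
    · have := sum_ite_le C (fun t => i = t ∧ b = true) zero_le_three
        (by rintro t - t' - ⟨rfl, -⟩ ⟨rfl, -⟩; rfl)
      simpa [gadgetPath, hubPath, Pi.single_apply, capA] using this
    · have := sum_ite_le C (fun t => j = φ t ∧ b = false) zero_le_three
        (by rintro t ht t' ht' ⟨rfl, -⟩ ⟨h, -⟩; exact hφ ht ht' h)
      simpa [gadgetPath, hubPath, Pi.single_apply, capA] using this
  · rw [one_mul, totalFlow_coverFlow]
    have := sum_ite_le Finset.univ (fun i => p = vN n EU i ∧ q = partner EU C i) zero_le_three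
      (by rintro i - j - ⟨rfl, -⟩ ⟨h, -⟩; simpa [vN] using h)
    refine le_trans (le_of_eq (Finset.sum_congr rfl fun i _ => ?_)) this
    rw [flowA_inr, flowB_inr]
    by_cases hi : i ∈ C <;> simp [hi, partner]

theorem exists_injOn_fin (hk : 0 < k) {C : Finset (Fin n)} (hC : C.card ≤ k) :
    ∃ φ : Fin n → Fin k, Set.InjOn φ C := by
  have : Nonempty (Fin k) := ⟨⟨0, hk⟩⟩
  obtain ⟨φ, -, hφ⟩ := C.finite_toSet.exists_injOn_of_encard_le (t := (Set.univ : Set (Fin k)))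
    (by simpa using hC)
  exact ⟨φ, hφ⟩

end APX
end MCRN

namespace MCRN
open APX

/-- if the 3-regular graph `(Fin n, EU)` has a vertex cover of size
at most `k`, then the constructed MCRN instance admits a matching and a segregated
splittable flow serving the demands with congestion at most `1`. -/
theorem apx_cover_implies_congestion_le_one
    (n k : ℕ) (EU : Finset (Sym2 (Fin n)))
    (hk : 0 < k) (hkn : k ≤ n)
    (hnd : ∀ e ∈ EU, ¬ e.IsDiag)
    (hreg : ∀ v : Fin n, (EU.filter (fun e => v ∈ e)).card = 3)
    (hvc : ∃ C : Finset (Fin n), IsVC n EU C ∧ C.card ≤ k) :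
    ∃ (M : Finset (Sym2 (VN n EU)))
      (f : VN n EU → VN n EU → SLink (VN n EU) (EL n k EU) → ℝ),
      IsMatching M ∧ IsFlow (Esrc n k EU) (Etgt n k EU) (DA n EU) M f ∧
        Segregated (DA n EU) f ∧ CongLE (capA n k EU) M f 1 := by
  obtain ⟨C, hC, hCk⟩ := hvc
  obtain ⟨φ, hφ⟩ := exists_injOn_fin hk hCk
  exact ⟨coverMatching EU C, coverFlow EU C φ, isMatching_coverMatching C,
    isFlow_coverFlow hreg C φ, segregated_coverFlow C φ, congLE_coverFlow hC hφ⟩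

end MCRN
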